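/- For every positive integer i and all x, y ∈ (0, 1) with x, y both greater than some θ < 1, the inequality |ψ^(i)(x)| + |ψ^(i)(y)| − |ψ^(i)(xy)| > 2|ψ^(i)(θ)| − |ψ^(i)(θ²)| holds. -/

import Mathlib

noncomputable def digamma : ℝ → ℝ := deriv (fun x => Real.log (Real.Gamma x))

noncomputable def polygamma (i : ℕ) : ℝ → ℝ := iteratedDeriv i digamma

open Filter Topology Set

/-- The Hurwitz-type series `∑ (x + n)⁻ᵖ`. -/
noncomputable def hurwitzSum (p : ℕ) (x : ℝ) : ℝ := ∑' n : ℕ, ((x + n)⁻¹) ^ p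

theorem summable_inv_add_pow {p : ℕ} (hp : 2 ≤ p) {x : ℝ} (hx : 0 < x) :
    Summable fun n : ℕ => ((x + n)⁻¹) ^ p := by
  have h := (Real.summable_one_div_nat_add_rpow x p).2 (by exact_mod_cast hp)
  refine h.congr fun n => ?_
  have : 0 < (n : ℝ) + x := by positivity
  rw [abs_of_pos this, Real.rpow_natCast, add_comm, one_div, inv_pow]

theorem hasDerivAt_inv_add_pow (p : ℕ) (a : ℝ) {x : ℝ} (hx : x + a ≠ 0) :
    HasDerivAt (fun z => ((z + a)⁻¹) ^ p) (-(p * ((x + a)⁻¹) ^ (p + 1))) x := by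
  have h := (((hasDerivAt_id x).add_const a).fun_inv hx).fun_pow p
  convert! h using 1
  rcases p with _ | p
  · simp
  · simp only [id, Nat.add_sub_cancel, pow_succ, ← one_div]
    field_simp

theorem hasDerivAt_hurwitzSum {p : ℕ} (hp : 2 ≤ p) {x : ℝ} (hx : 0 < x) :
    HasDerivAt (hurwitzSum p) (-(p * hurwitzSum (p + 1) x)) x := by
  have hδ : 0 < x / 2 := by positivity
  have key := hasDerivAt_tsum_of_isPreconnected
    (g := fun (n : ℕ) (z : ℝ) => ((z + n)⁻¹) ^ p) (t := Ioi (x / 2)) (y₀ := x) (y := x)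
    (g' := fun (n : ℕ) (z : ℝ) => -(p * ((z + n)⁻¹) ^ (p + 1)))
    ((summable_inv_add_pow (p := p + 1) (by omega) hδ).mul_left (p : ℝ)) isOpen_Ioi
    isPreconnected_Ioi (fun n z hz => hasDerivAt_inv_add_pow p n ?_) (fun n z hz => ?_)
    (by simpa using hx) (summable_inv_add_pow hp hx) (by simpa using hx)
  · rwa [tsum_neg, tsum_mul_left] at key
  · have : 0 < z := hδ.trans hz
    positivity
  · have hz' : x / 2 < z := hz
    have : 0 < z := hδ.trans hz
    rw [norm_neg, Real.norm_of_nonneg (by positivity)]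
    gcongr

/-- The terms of the series expansion of `digamma x + 1 / x`; the term with `n = 0` is
`-(x + 1)⁻¹` because `Real.log 0 = 0`. -/
noncomputable def digammaTerm (n : ℕ) (x : ℝ) : ℝ :=
  Real.log (n + 1) - Real.log n - (x + (n + 1))⁻¹

theorem sum_range_digammaTerm (N : ℕ) (x : ℝ) :
    ∑ n ∈ Finset.range N, digammaTerm n x
      = Real.log N - ∑ n ∈ Finset.range N, (x + (n + 1))⁻¹ := by
  induction N with
  | zero => simp
  | succ N ih =>
    rw [Finset.sum_range_succ, ih, Finset.sum_range_succ, digammaTerm]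
    push_cast
    ring

theorem norm_digammaTerm_le {n : ℕ} (hn : 1 ≤ n) {R x : ℝ} (hx : 0 < x) (hR : x < R) :
    ‖digammaTerm n x‖ ≤ (R + 1) * ((n : ℝ) ^ 2)⁻¹ := by
  have hn0 : (0 : ℝ) < n := by exact_mod_cast hn
  have hlog : Real.log (n + 1) - Real.log n = Real.log ((n + 1) / n) :=
    (Real.log_div (by positivity) (by positivity)).symm
  have hup := Real.log_le_sub_one_of_pos (x := (n + 1 : ℝ) / n) (by positivity)
  have hlo := Real.one_sub_inv_le_log_of_pos (x := (n + 1 : ℝ) / n) (by positivity)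
  have h1 : (n + 1 : ℝ) / n - 1 = (n : ℝ)⁻¹ := by field_simp; ring
  have h2 : 1 - ((n + 1 : ℝ) / n)⁻¹ = ((n : ℝ) + 1)⁻¹ := by field_simp; ring
  have h3 : (x + (n + 1))⁻¹ ≤ ((n : ℝ) + 1)⁻¹ :=
    inv_anti₀ (by positivity) (by linarith)
  have h4 : (n : ℝ)⁻¹ - (x + (n + 1))⁻¹ ≤ (R + 1) * ((n : ℝ) ^ 2)⁻¹ := by
    have : (n : ℝ)⁻¹ - (x + (n + 1))⁻¹ = (x + 1) * (n * (x + (n + 1)))⁻¹ := by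
      field_simp; ring
    rw [this]
    have : (n : ℝ) ^ 2 ≤ n * (x + (n + 1)) := by nlinarith
    have : 0 ≤ R + 1 := by linarith
    gcongr
  rw [digammaTerm, Real.norm_of_nonneg (by linarith)]
  linarith

theorem hasDerivAt_logGammaSeq (N : ℕ) {x : ℝ} (hx : 0 < x) :
    HasDerivAt (fun z => Real.BohrMollerup.logGammaSeq z N + Real.log z)
      (∑ n ∈ Finset.range N, digammaTerm n x) x := by
  have h : HasDerivAt (fun z : ℝ => ∑ m ∈ Finset.range N, Real.log (z + (m + 1)))
      (∑ m ∈ Finset.range N, (x + (m + 1))⁻¹) x := by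
    refine HasDerivAt.fun_sum fun m _ => ?_
    simpa using ((hasDerivAt_id x).add_const (m + 1 : ℝ)).log (by simp only [id]; positivity)
  have h' := (((hasDerivAt_id x).mul_const (Real.log N)).add_const
    (Real.log (Nat.factorial N))).sub h
  rw [sum_range_digammaTerm]
  convert! h' using 1
  · ext z
    simp only [Real.BohrMollerup.logGammaSeq, Finset.sum_range_succ', Pi.sub_apply, id]
    push_cast
    simp only [add_zero]
    ring
  · simp

theorem hasDerivAt_log_Gamma_add_log {x : ℝ} (hx : 0 < x) :
    HasDerivAt (fun z => Real.log (Real.Gamma z) + Real.log z) (∑' n, digammaTerm n x) x := by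
  refine hasDerivAt_of_tendstoUniformlyOn (s := Ioo 0 (x + 1)) isOpen_Ioo
    (g' := fun z => ∑' n, digammaTerm n z)
    (tendstoUniformlyOn_tsum_nat_eventually
      (u := fun n : ℕ => (x + 1 + 1) * ((n : ℝ) ^ 2)⁻¹)
      ((Real.summable_nat_pow_inv.2 one_lt_two).mul_left _) ?_)
    (Eventually.of_forall fun N z hz => hasDerivAt_logGammaSeq N hz.1)
    (fun z hz => (Real.BohrMollerup.tendsto_log_gamma hz.1).add_const _) ⟨hx, by linarith⟩
  filter_upwards [eventually_ge_atTop 1] with n hn z hz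
  exact norm_digammaTerm_le hn hz.1 hz.2

theorem digamma_eq {x : ℝ} (hx : 0 < x) : digamma x = ∑' n, digammaTerm n x - x⁻¹ := by
  have h := (hasDerivAt_log_Gamma_add_log hx).sub (Real.hasDerivAt_log hx.ne')
  refine HasDerivAt.deriv ?_
  convert! h using 1
  ext z
  simp

theorem hasDerivAt_digamma {x : ℝ} (hx : 0 < x) : HasDerivAt digamma (hurwitzSum 2 x) x := by
  have hs : Summable fun n => digammaTerm n x := by
    refine Summable.of_norm_bounded_eventually_nat
      ((Real.summable_nat_pow_inv.2 one_lt_two).mul_left (x + 1 + 1)) ?_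
    filter_upwards [eventually_ge_atTop 1] with n hn
    exact norm_digammaTerm_le hn hx (by linarith)
  have h := hasDerivAt_tsum_of_isPreconnected (g := digammaTerm) (t := Ioi 0) (y₀ := x) (y := x)
    (g' := fun (n : ℕ) (z : ℝ) => ((z + (n + 1))⁻¹) ^ 2) (u := fun n : ℕ => ((1 + n : ℝ)⁻¹) ^ 2)
    (summable_inv_add_pow le_rfl one_pos) isOpen_Ioi isPreconnected_Ioi
    (fun n z hz => ?_) (fun n z hz => ?_) hx hs hx
  · have h' := h.sub (hasDerivAt_inv hx.ne')
    have e : hurwitzSum 2 x = ∑' n : ℕ, ((x + (n + 1))⁻¹) ^ 2 - -(x ^ 2)⁻¹ := by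
      rw [hurwitzSum, (summable_inv_add_pow le_rfl hx).tsum_eq_zero_add]
      push_cast
      rw [add_zero, inv_pow]
      ring
    rw [e]
    refine h'.congr_of_eventuallyEq ?_
    filter_upwards [Ioi_mem_nhds hx] with z hz
    exact digamma_eq hz
  · have hz' : (0 : ℝ) < z := hz
    have := (hasDerivAt_inv_add_pow 1 (n + 1 : ℝ) (x := z) (by positivity)).const_sub
      (Real.log (n + 1) - Real.log n)
    convert! this using 1
    · ext w
      simp [digammaTerm]
    · simp
  · have hz' : (0 : ℝ) < z := hz
    rw [Real.norm_of_nonneg (by positivity)]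
    exact pow_le_pow_left₀ (by positivity) (inv_anti₀ (by positivity) (by linarith)) 2

theorem polygamma_succ_eq (i : ℕ) {x : ℝ} (hx : 0 < x) :
    polygamma (i + 1) x = (-1) ^ i * (i + 1).factorial * hurwitzSum (i + 2) x := by
  induction i generalizing x with
  | zero =>
    simpa [polygamma] using (hasDerivAt_digamma hx).deriv
  | succ i ih =>
    rw [polygamma, iteratedDeriv_succ]
    have h : HasDerivAt (iteratedDeriv (i + 1) digamma) _ x :=
      ((hasDerivAt_hurwitzSum (p := i + 2) (by omega) hx).const_mul
        ((-1) ^ i * ((i + 1).factorial : ℝ))).congr_of_eventuallyEq <| by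
          filter_upwards [Ioi_mem_nhds hx] with z hz
          exact ih hz
    rw [h.deriv, Nat.factorial_succ (i + 1)]
    push_cast
    ring

theorem hurwitzSum_nonneg (p : ℕ) {x : ℝ} (hx : 0 < x) : 0 ≤ hurwitzSum p x :=
  tsum_nonneg fun n => by positivity

theorem abs_polygamma_succ (i : ℕ) {x : ℝ} (hx : 0 < x) :
    |polygamma (i + 1) x| = (i + 1).factorial * hurwitzSum (i + 2) x := by
  rw [polygamma_succ_eq i hx, abs_mul, abs_mul, abs_pow, abs_neg, abs_one, one_pow, one_mul,
    Nat.abs_cast, abs_of_nonneg (hurwitzSum_nonneg _ hx)]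

/-- The trapezoidal rule overestimates the integral of a power, in algebraic form. -/
theorem trapezoid_pow_le (p : ℕ) {a b : ℝ} (hb : 0 ≤ b) (hab : b ≤ a) :
    2 * (a * b) * (a ^ p - b ^ p) ≤ p * (a - b) * (a ^ (p + 1) + b ^ (p + 1)) := by
  have ha : 0 ≤ a := hb.trans hab
  induction p with
  | zero => simp
  | succ p ih =>
    have h1 : b ^ (p + 1) ≤ a ^ (p + 1) := pow_le_pow_left₀ hb hab _
    have h2 : 0 ≤ (a - b) * (a ^ (p + 1) - b ^ (p + 1)) :=
      mul_nonneg (sub_nonneg.2 hab) (sub_nonneg.2 h1)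
    have h3 := mul_nonneg (mul_nonneg (Nat.cast_nonneg (α := ℝ) p) (sub_nonneg.2 hab)) h2
    have h4 := mul_nonneg (sub_nonneg.2 hab) h2
    have h5 := mul_le_mul_of_nonneg_left ih (add_nonneg ha hb)
    push_cast
    simp only [pow_succ] at *
    nlinarith

theorem inv_sub_inv_add_one {t : ℝ} (ht : 0 < t) :
    t⁻¹ - (t + 1)⁻¹ = t⁻¹ * (t + 1)⁻¹ := by
  field_simp
  ring

theorem lower_telescope (p : ℕ) {t : ℝ} (ht : 0 < t) :
    (2 * t⁻¹ ^ p + p * t⁻¹ ^ (p + 1)) - (2 * (t + 1)⁻¹ ^ p + p * (t + 1)⁻¹ ^ (p + 1))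
      ≤ 2 * p * t⁻¹ ^ (p + 1) := by
  have hb : 0 < (t + 1)⁻¹ := by positivity
  have hle : (t + 1)⁻¹ ≤ t⁻¹ := by gcongr; linarith
  have h := trapezoid_pow_le p hb.le hle
  rw [inv_sub_inv_add_one ht] at h
  have hpos : 0 < t⁻¹ * (t + 1)⁻¹ := by positivity
  have : 2 * (t⁻¹ ^ p - (t + 1)⁻¹ ^ p) ≤ p * (t⁻¹ ^ (p + 1) + (t + 1)⁻¹ ^ (p + 1)) := by
    refine le_of_mul_le_mul_left ?_ hpos
    linarith
  linarith

theorem upper_telescope (q : ℕ) {t : ℝ} (ht : 0 < t) :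
    q * t⁻¹ ^ (q + 1) ≤
      (t⁻¹ ^ q + q * t⁻¹ ^ (q + 1)) - ((t + 1)⁻¹ ^ q + q * (t + 1)⁻¹ ^ (q + 1)) := by
  have hb : 0 < (t + 1)⁻¹ := by positivity
  have hle : (t + 1)⁻¹ ≤ t⁻¹ := by gcongr; linarith
  have h1 : (t + 1)⁻¹ * (1 + (t + 1)⁻¹) ≤ t⁻¹ := by
    nlinarith [inv_sub_inv_add_one ht]
  have h2 : ((t + 1)⁻¹ * (1 + (t + 1)⁻¹)) ^ q ≤ t⁻¹ ^ q := by gcongr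
  have h3 := one_add_mul_le_pow (a := (t + 1)⁻¹) (by linarith) q
  have h4 := mul_le_mul_of_nonneg_left h3 (pow_nonneg hb.le q)
  rw [mul_pow] at h2
  rw [pow_succ (t + 1)⁻¹ q]
  linarith

theorem le_hurwitzSum {p : ℕ} (hp : 1 ≤ p) {x : ℝ} (hx : 0 < x) :
    2 * x⁻¹ ^ p + p * x⁻¹ ^ (p + 1) ≤ 2 * p * hurwitzSum (p + 1) x := by
  have hsum (N : ℕ) : (2 * x⁻¹ ^ p + p * x⁻¹ ^ (p + 1))
      - (2 * (x + N)⁻¹ ^ p + p * (x + N)⁻¹ ^ (p + 1))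
        ≤ 2 * p * ∑ n ∈ Finset.range N, (x + n)⁻¹ ^ (p + 1) := by
    induction N with
    | zero => simp
    | succ N ih =>
      have h := lower_telescope p (t := x + N) (by positivity)
      rw [Finset.sum_range_succ]
      push_cast
      rw [← add_assoc]
      linarith
  have hinv : Tendsto (fun N : ℕ => (x + N)⁻¹) atTop (𝓝 0) :=
    tendsto_inv_atTop_zero.comp (tendsto_atTop_add_const_left _ x tendsto_natCast_atTop_atTop)
  have hlim := ((hinv.pow p).const_mul 2).add ((hinv.pow (p + 1)).const_mul (p : ℝ))
  have hl := hlim.const_sub (2 * x⁻¹ ^ p + p * x⁻¹ ^ (p + 1))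
  have hr := ((summable_inv_add_pow (p := p + 1) (by omega) hx).hasSum.tendsto_sum_nat).const_mul
    (2 * p : ℝ)
  refine le_of_tendsto_of_tendsto' ?_ hr hsum
  simpa [show p ≠ 0 by omega] using hl

theorem hurwitzSum_le {q : ℕ} (hq : 1 ≤ q) {x : ℝ} (hx : 0 < x) :
    q * hurwitzSum (q + 1) x ≤ x⁻¹ ^ q + q * x⁻¹ ^ (q + 1) := by
  have hsum (N : ℕ) : q * ∑ n ∈ Finset.range N, (x + n)⁻¹ ^ (q + 1) ≤
      (x⁻¹ ^ q + q * x⁻¹ ^ (q + 1)) - ((x + N)⁻¹ ^ q + q * (x + N)⁻¹ ^ (q + 1)) := by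
    induction N with
    | zero => simp
    | succ N ih =>
      have h := upper_telescope q (t := x + N) (by positivity)
      rw [Finset.sum_range_succ]
      push_cast
      rw [← add_assoc]
      linarith
  have hr := ((summable_inv_add_pow (p := q + 1) (by omega) hx).hasSum.tendsto_sum_nat).const_mul
    (q : ℝ)
  refine le_of_tendsto' hr fun N => (hsum N).trans ?_
  have : 0 ≤ (x + N)⁻¹ ^ q + q * (x + N)⁻¹ ^ (q + 1) := by positivity
  linarith

theorem hurwitzSum_lt_mul_hurwitzSum_succ {q : ℕ} (hq : 2 ≤ q) {x : ℝ} (hx : 0 < x) :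
    hurwitzSum (q + 1) x < (q + 1) * x * hurwitzSum (q + 2) x := by
  have hlo := le_hurwitzSum (p := q + 1) (by omega) hx
  have hup := hurwitzSum_le (q := q) (by omega) hx
  have hq' : (2 : ℝ) ≤ q := by exact_mod_cast hq
  have hlo' := mul_le_mul_of_nonneg_left hlo hx.le
  push_cast at hlo'
  have e1 : x * x⁻¹ ^ (q + 1) = x⁻¹ ^ q := by rw [pow_succ]; field_simp
  have e2 : x * x⁻¹ ^ (q + 1 + 1) = x⁻¹ ^ (q + 1) := by rw [pow_succ _ (q + 1)]; field_simp
  have hA : 0 < x⁻¹ ^ q := by positivity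
  have hB : 0 < x⁻¹ ^ (q + 1) := by positivity
  have h1 : 2 * x⁻¹ ^ q + (q + 1) * x⁻¹ ^ (q + 1)
      ≤ 2 * ((q + 1) * x * hurwitzSum (q + 2) x) := by
    calc _ = x * (2 * x⁻¹ ^ (q + 1) + (q + 1) * x⁻¹ ^ (q + 1 + 1)) := by
            rw [mul_add, mul_left_comm, e1, mul_left_comm x, e2]
      _ ≤ _ := hlo'
      _ = _ := by ring
  have h2 := mul_le_mul_of_nonneg_left h1 (zero_le_two.trans hq')
  have h3 := mul_nonneg (sub_nonneg.2 hq') hA.le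
  have h4 : 0 ≤ (q : ℝ) * (q - 1) * x⁻¹ ^ (q + 1) :=
    mul_nonneg (mul_nonneg (by linarith) (by linarith)) hB.le
  refine lt_of_mul_lt_mul_left (a := (q : ℝ)) ?_ (by linarith)
  linarith

theorem strictAntiOn_mul_hurwitzSum {p : ℕ} (hp : 3 ≤ p) :
    StrictAntiOn (fun x => x * hurwitzSum p x) (Ioi 0) := by
  have hd {x : ℝ} (hx : 0 < x) := (hasDerivAt_id x).mul (hasDerivAt_hurwitzSum (p := p)
    (by omega) hx)
  refine strictAntiOn_of_deriv_neg (convex_Ioi 0)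
    (fun x hx => (hd hx).continuousAt.continuousWithinAt) fun x hx => ?_
  rw [interior_Ioi] at hx
  obtain ⟨q, rfl⟩ : ∃ q, p = q + 1 := ⟨p - 1, by omega⟩
  have h := hurwitzSum_lt_mul_hurwitzSum_succ (q := q) (by omega) hx
  refine (hd hx).deriv.trans_lt ?_
  push_cast
  simp only [id]
  linarith

theorem strictMonoOn_hurwitzSum_sub {p : ℕ} (hp : 2 ≤ p) {y : ℝ} (hy0 : 0 < y) (hy1 : y < 1) :
    StrictMonoOn (fun x => hurwitzSum p x - hurwitzSum p (x * y)) (Ioi 0) := by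
  have hd {x : ℝ} (hx : 0 < x) := (hasDerivAt_hurwitzSum hp hx).sub
    ((hasDerivAt_hurwitzSum hp (mul_pos hx hy0)).comp x ((hasDerivAt_id x).mul_const y))
  refine strictMonoOn_of_deriv_pos (convex_Ioi 0)
    (fun x hx => (hd hx).continuousAt.continuousWithinAt) fun x hx => ?_
  rw [interior_Ioi] at hx
  have hx' : 0 < x := hx
  have h := strictAntiOn_mul_hurwitzSum (p := p + 1) (by omega) (mul_pos hx' hy0) hx
    (mul_lt_of_lt_one_right hx' hy1)
  have h' : hurwitzSum (p + 1) x < y * hurwitzSum (p + 1) (x * y) := by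
    refine lt_of_mul_lt_mul_left ?_ hx'.le
    simpa only [mul_assoc] using h
  refine lt_of_lt_of_eq ?_ (hd hx).deriv.symm
  have hp' : (0 : ℝ) < p := by exact_mod_cast (by omega : 0 < p)
  have := mul_lt_mul_of_pos_left h' hp'
  linarith

theorem stmt13 (i : ℕ) (hi : 0 < i) (θ x y : ℝ)
    (hθ : 0 < θ) (hθx : θ < x) (hx : x < 1) (hθy : θ < y) (hy : y < 1) :
    2 * |polygamma i θ| - |polygamma i (θ ^ 2)| <
      |polygamma i x| + |polygamma i y| - |polygamma i (x * y)| := by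
  obtain ⟨i, rfl⟩ : ∃ j, i = j + 1 := ⟨i - 1, by omega⟩
  have hx0 := hθ.trans hθx
  have hy0 := hθ.trans hθy
  have h1 := strictMonoOn_hurwitzSum_sub (p := i + 2) (by omega) hθ (hθx.trans hx) hθ hx0 hθx
  have h2 := strictMonoOn_hurwitzSum_sub (p := i + 2) (by omega) hx0 hx hθ hy0 hθy
  simp only [mul_comm θ x, mul_comm y x, ← sq] at h1 h2
  rw [abs_polygamma_succ i hθ, abs_polygamma_succ i hx0, abs_polygamma_succ i hy0,
    abs_polygamma_succ i (mul_pos hx0 hy0), abs_polygamma_succ i (pow_pos hθ 2)]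
  have hf : (0 : ℝ) < (i + 1).factorial := by positivity
  have h := mul_lt_mul_of_pos_left (add_lt_add h1 h2) hf
  linarith
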